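/- For any finite-dimensional Hilbert space V, any positive semidefinite operator τ on V, and any projective measurement {P_0, ..., P_n} (pairwise orthogonal projections summing to the identity), setting τ' = Σ_i P_i τ P_i, the inequality ‖τ'‖²_{1+ε} ≤ ‖τ‖²_{1+ε} - ε‖τ - τ'‖²_{1+ε} holds for all ε ∈ (0,1), where ‖·‖_{1+ε} denotes the Schatten (1+ε)-norm. -/

import Mathlib

open scoped ComplexOrder

/-- Schatten (1+ε)-type norm of a Hermitian matrix, via its real eigenvalues. -/
noncomputable def schattenNorm {n : Type*} [Fintype n] [DecidableEq n]
    (p : ℝ) (A : Matrix n n ℂ) (hA : A.IsHermitian) : ℝ :=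
  (∑ i, |hA.eigenvalues i| ^ p) ^ (1 / p)


namespace HuangShi
open Matrix

theorem tele (G : ℝ → ℝ) (C : ℝ)
    (h : ∀ s t, 0 ≤ s → s ≤ t → t ≤ 1 → G t - G s ≥ -C * (t-s)^2) :
    ∀ T, 0 ≤ T → T ≤ 1 → G 0 ≤ G T := by
  intro T hT0 hT1
  have key : ∀ n : ℕ, 0 < n → G T - G 0 ≥ -C * T^2 / n := by
    intro n hn
    have hn' : (0:ℝ) < n := by exact_mod_cast hn
    have : ∀ k : ℕ, k ≤ n → G (k * (T / n)) - G 0 ≥ k * (-C * (T/n)^2) := by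
      intro k
      induction k with
      | zero => intro _; simp
      | succ k ih =>
        intro hk
        have h1 := ih (by omega)
        have h2 := h (k * (T/n)) ((k+1:ℕ) * (T/n)) (by positivity) (by
          have : 0 ≤ T/n := by positivity
          push_cast; nlinarith) (by
          have : ((k+1:ℕ):ℝ) ≤ n := by exact_mod_cast hk
          calc ((k+1:ℕ):ℝ) * (T/n) ≤ n * (T/n) := by gcongr
            _ = T := by field_simp
            _ ≤ 1 := hT1)
        push_cast at h2 ⊢
        have e : ((k:ℝ)+1) * (T/n) - k * (T/n) = T/n := by ring
        rw [e] at h2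
        linarith
    have h3 := this n le_rfl
    have e1 : (n:ℝ) * (T/n) = T := by field_simp
    rw [e1] at h3
    have e2 : (n:ℝ) * (-C * (T/n)^2) = -C * T^2 / n := by field_simp
    linarith
  have lim : Filter.Tendsto (fun n : ℕ => -C * T^2 / (n:ℝ)) Filter.atTop (nhds 0) :=
    tendsto_const_div_atTop_nhds_zero_nat _
  have := le_of_tendsto lim (b := G T - G 0) (by
    filter_upwards [Filter.eventually_gt_atTop 0] with n hn using key n hn)
  linarith

/-- Hölder -/
theorem holder_aux {n : Type*} [Fintype n] (p : ℝ) (hp1 : 1 < p) (hp2 : p < 2) (y m : n → ℝ)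
    (hm : ∀ i, 0 < m i) :
    (∑ i, |y i| ^ p) ^ (2/p) ≤ (∑ i, (y i)^2 * m i ^ (p-2)) * (∑ i, m i ^ p) ^ (2/p-1) := by
  have hc : (2/p).HolderConjugate (2/(2-p)) := by
    rw [Real.holderConjugate_iff]
    constructor
    · rw [lt_div_iff₀ (by linarith)]; linarith
    · field_simp; ring
  have H := Real.inner_le_Lp_mul_Lq_of_nonneg Finset.univ hc
    (f := fun i => (|y i|^p) * m i ^ ((p-2)*(p/2))) (g := fun i => m i ^ ((2-p)*(p/2)))
    (fun i _ => by have := hm i; positivity) (fun i _ => by have := hm i; positivity)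
  have e1 : ∀ i, (|y i|^p) * m i ^ ((p-2)*(p/2)) * m i ^ ((2-p)*(p/2)) = |y i|^p := by
    intro i
    rw [mul_assoc, ← Real.rpow_add (hm i)]
    have : (p-2)*(p/2) + (2-p)*(p/2) = 0 := by ring
    rw [this]; simp
  have e2 : ∀ i, ((|y i|^p) * m i ^ ((p-2)*(p/2)))^(2/p) = (y i)^2 * m i ^ (p-2) := by
    intro i
    have := hm i
    rw [Real.mul_rpow (by positivity) (by positivity), ← Real.rpow_mul (abs_nonneg _),
      ← Real.rpow_mul this.le]
    have a1 : p * (2/p) = (2:ℕ) := by push_cast; field_simp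
    have a2 : (p-2)*(p/2)*(2/p) = p-2 := by field_simp
    rw [a1, a2, Real.rpow_natCast, sq_abs]
  have e3 : ∀ i, (m i ^ ((2-p)*(p/2)))^(2/(2-p)) = m i ^ p := by
    intro i
    rw [← Real.rpow_mul (hm i).le]
    have : 2 - p ≠ 0 := by linarith
    congr 1; field_simp
  simp only [e1, e2, e3] at H
  have S1 : 0 ≤ ∑ i, |y i|^p := Finset.sum_nonneg fun i _ => by positivity
  have S2 : 0 ≤ ∑ i, (y i)^2 * m i ^ (p-2) := Finset.sum_nonneg fun i _ => by
    have := hm i; positivity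
  have S3 : 0 ≤ ∑ i, m i ^ p := Finset.sum_nonneg fun i _ => by
    have := hm i; positivity
  calc _ ≤ _ := Real.rpow_le_rpow S1 H (by positivity)
    _ = _ := by
      rw [Real.mul_rpow (by positivity) (by positivity), ← Real.rpow_mul S2, ← Real.rpow_mul S3]
      have a1 : 1/(2/p) * (2/p) = 1 := by field_simp
      have a2 : 1/(2/(2-p)) * (2/p) = 2/p-1 := by
        have : 2 - p ≠ 0 := by linarith
        field_simp
      rw [a1, a2, Real.rpow_one]

/-- scalar: mean value lower bound -/
theorem mv_aux (r : ℝ) (hr0 : 0 < r) (hr1 : r < 1) (a b m : ℝ) (ha : 0 < a) (hb : 0 < b)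
    (ham : a ≤ m) (hbm : b ≤ m) :
    r * m ^ (r-1) * (b - a)^2 ≤ (b - a) * (b^r - a^r) := by
  wlog hab : a ≤ b generalizing a b
  · have := this b a hb ha hbm ham (by linarith)
    nlinarith
  -- tangent: concavity at b : a^r ≤ b^r + r b^(r-1) (a-b)
  have hmp : 0 < m := by linarith
  have h1 : (a/b)^r ≤ 1 + r * (a/b - 1) := by
    have := rpow_one_add_le_one_add_mul_self (s := a/b - 1) (p := r)
      (by have : 0 < a/b := by positivity
          linarith) hr0.le hr1.le
    simpa using this
  rw [Real.div_rpow ha.le hb.le, div_le_iff₀ (by positivity)] at h1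
  have h2 : b^r = b^(r-1) * b := by
    rw [← Real.rpow_add_one hb.ne']; simp
  have h3 : b^r - a^r ≥ r * b^(r-1) * (b-a) := by
    have : (1 + r*(a/b-1)) * b^r = b^r - r * b^(r-1)*(b-a) := by
      rw [h2]; field_simp; ring
    linarith
  have h4 : m^(r-1) ≤ b^(r-1) := Real.rpow_le_rpow_of_nonpos hb hbm (by linarith)
  have h5 : r * m^(r-1) * (b-a) ≤ b^r - a^r := by
    have : 0 ≤ b - a := by linarith
    calc r * m^(r-1) * (b-a) ≤ r * b^(r-1)*(b-a) := by gcongr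
      _ ≤ _ := h3
  nlinarith

theorem core_real {n : Type*} [Fintype n] (r : ℝ) (hr0 : 0 < r) (hr1 : r < 1)
    (φ φd : ℝ → ℝ) (x y : n → ℝ) (δ : ℝ) (hδ : 0 < δ)
    (hx : ∀ t, 0 ≤ t → t ≤ 1 → ∀ i, δ ≤ x i + t * y i)
    (ha : ∀ s t, 0 ≤ s → s ≤ t → t ≤ 1 → (t-s) * ((1+r) * φd s) ≤ φ t - φ s)
    (hb : ∀ s t, 0 ≤ s → s ≤ t → t ≤ 1 →
      ∑ i, y i * ((x i + t * y i)^r - (x i + s * y i)^r) ≤ φd t - φd s)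
    (hc : ∀ t, 0 ≤ t → t ≤ 1 → ∑ i, (x i + t * y i)^(1+r) ≤ φ t)
    (hd : 0 ≤ φd 0) :
    φ 0 ^ (2/(1+r)) + r * (∑ i, |y i|^(1+r))^(2/(1+r)) ≤ φ 1 ^ (2/(1+r)) := by
  rcases isEmpty_or_nonempty n with hn | hn
  · simp only [Finset.univ_eq_empty, Finset.sum_empty] at *
    rw [Real.zero_rpow (by positivity)]
    have := ha 0 1 le_rfl zero_le_one le_rfl
    have h0 := hc 0 le_rfl zero_le_one
    have : φ 0 ≤ φ 1 := by nlinarith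
    simpa using Real.rpow_le_rpow h0 this (by positivity)
  set p := 1 + r with hp
  set N := (∑ i, |y i|^p)^(2/p) with hN
  have hN0 : 0 ≤ N := by
    have : 0 ≤ ∑ i, |y i|^p := Finset.sum_nonneg fun i _ => by positivity
    positivity
  have hφ : ∀ t, 0 ≤ t → t ≤ 1 → 0 < φ t := fun t h0 h1 =>
    lt_of_lt_of_le (Finset.sum_pos (fun i _ => by
      have := hx t h0 h1 i
      have : 0 < x i + t * y i := by linarith
      positivity) Finset.univ_nonempty) (hc t h0 h1)
  have hmono : ∀ s t, 0 ≤ s → s ≤ t → t ≤ 1 → φd s ≤ φd t := by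
    intro s t h0 h1 h2
    have := hb s t h0 h1 h2
    have : 0 ≤ ∑ i, y i * ((x i + t * y i)^r - (x i + s * y i)^r) := by
      apply Finset.sum_nonneg
      intro i _
      have p1 := hx s h0 (by linarith) i
      have p2 := hx t (by linarith) h2 i
      rcases le_total 0 (y i) with hy | hy
      · apply mul_nonneg hy
        have : (x i + s * y i)^r ≤ (x i + t * y i)^r :=
          Real.rpow_le_rpow (by linarith) (by nlinarith) hr0.le
        linarith
      · apply mul_nonneg_of_nonpos_of_nonpos hy
        have : (x i + t * y i)^r ≤ (x i + s * y i)^r :=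
          Real.rpow_le_rpow (by linarith) (by nlinarith) hr0.le
        linarith
    linarith
  have hd' : ∀ t, 0 ≤ t → t ≤ 1 → 0 ≤ φd t := fun t h0 h1 => hd.trans (hmono 0 t le_rfl h0 h1)
  have hφm : ∀ s t, 0 ≤ s → s ≤ t → t ≤ 1 → φ s ≤ φ t := by
    intro s t h0 h1 h2
    have := ha s t h0 h1 h2
    have : 0 ≤ (t-s) * (p * φd s) :=
      mul_nonneg (by linarith) (mul_nonneg (by linarith) (hd' s h0 (by linarith)))
    linarith
  set C := (∑ i, |y i|)/δ with hC
  have hC0 : 0 ≤ C := by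
    have : 0 ≤ ∑ i, |y i| := Finset.sum_nonneg fun i _ => abs_nonneg _
    positivity
  have hpne : p ≠ 0 := by linarith
  have hap : 0 < 2/p - 1 := by
    have : 1 < 2/p := by rw [lt_div_iff₀ (by linarith)]; linarith
    linarith
  -- first telescoping
  have hG : ∀ T, 0 ≤ T → T ≤ 1 → r * N * T ≤ φ T ^ (2/p-1) * φd T := by
    have := tele (fun t => φ t ^ (2/p-1) * φd t - r * N * t) (r * N * C) ?_
    · intro T h0 h1
      have := this T h0 h1
      have z : 0 ≤ φ 0 ^ (2/p-1) * φd 0 := mul_nonneg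
        (Real.rpow_nonneg (hφ 0 le_rfl zero_le_one).le _) hd
      simp only [mul_zero, sub_zero] at this
      linarith
    intro s t h0 h1 h2
    have hs1 : s ≤ 1 := by linarith
    have ht0 : 0 ≤ t := by linarith
    set h := t - s with hh
    have hh0 : 0 ≤ h := by linarith
    set m : n → ℝ := fun i => (1 + C * h) * (x i + s * y i) with hm
    have hxs := hx s h0 hs1
    have hxt := hx t ht0 h2
    have hm0 : ∀ i, 0 < m i := fun i => by
      have := hxs i
      have : 0 < x i + s * y i := by linarith
      positivity
    have hyC : ∀ i, |y i| ≤ C * δ := by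
      intro i
      have : C * δ = ∑ i, |y i| := by rw [hC]; field_simp
      rw [this]
      exact Finset.single_le_sum (f := fun i => |y i|) (fun i _ => abs_nonneg _) (Finset.mem_univ i)
    have hsm : ∀ i, x i + s * y i ≤ m i := fun i => by
      have := hxs i
      have : 0 ≤ C * h * (x i + s * y i) := mul_nonneg (by positivity) (by linarith)
      simp only [hm]; linarith
    have htm : ∀ i, x i + t * y i ≤ m i := fun i => by
      have h3 : C * h * δ ≤ C * h * (x i + s * y i) := by
        apply mul_le_mul_of_nonneg_left (hxs i); positivity
      have h4 : h * y i ≤ h * (C * δ) := by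
        apply mul_le_mul_of_nonneg_left ((le_abs_self _).trans (hyC i)) hh0
      have : x i + t * y i = (x i + s * y i) + h * y i := by rw [hh]; ring
      simp only [hm]; nlinarith
    have k1 : h * (r * ∑ i, (y i)^2 * m i ^ (p-2)) ≤
        ∑ i, y i * ((x i + t * y i)^r - (x i + s * y i)^r) := by
      rcases hh0.eq_or_lt with he | hpos
      · rw [← he]
        have : t = s := by linarith
        subst this; simp
      rw [Finset.mul_sum, Finset.mul_sum]
      apply Finset.sum_le_sum
      intro i _
      have := mv_aux r hr0 hr1 (x i + s * y i) (x i + t * y i) (m i)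
        (by linarith [hxs i]) (by linarith [hxt i]) (hsm i) (htm i)
      have e : x i + t * y i - (x i + s * y i) = h * y i := by rw [hh]; ring
      rw [e] at this
      have e2 : p - 2 = r - 1 := by rw [hp]; ring
      rw [e2]
      refine le_of_mul_le_mul_left ?_ hpos
      linarith
    have k2 := holder_aux p (by linarith) (by linarith) y m hm0
    have k3 : (∑ i, m i ^ p)^(2/p-1) ≤ (1 + C * h) * φ s ^ (2/p-1) := by
      have e : ∑ i, m i ^ p = (1+C*h)^p * ∑ i, (x i + s * y i)^p := by
        rw [Finset.mul_sum]
        refine Finset.sum_congr rfl fun i _ => ?_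
        simp only [hm]
        rw [Real.mul_rpow (by positivity) (by linarith [hxs i])]
      have q0 : 0 ≤ ∑ i, (x i + s * y i)^p := Finset.sum_nonneg fun i _ => 
        Real.rpow_nonneg (by linarith [hxs i]) _
      rw [e, Real.mul_rpow (by positivity) q0, ← Real.rpow_mul (by positivity)]
      have l1 : (1+C*h)^(p * (2/p-1)) ≤ (1+C*h)^(1:ℝ) := by
        apply Real.rpow_le_rpow_of_exponent_le
        · have : 0 ≤ C * h := by positivity
          linarith
        · have : p * (2/p - 1) = 2 - p := by field_simp
          rw [this]; linarith
      rw [Real.rpow_one] at l1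
      have l2 := Real.rpow_le_rpow q0 (hc s h0 hs1) hap.le
      gcongr
    set Q := ∑ i, (y i)^2 * m i ^ (p-2) with hQ
    have hQ0 : 0 ≤ Q := Finset.sum_nonneg fun i _ => by
      have := hm0 i; positivity
    set F := φ s ^ (2/p-1) with hF
    have hF0 : 0 ≤ F := Real.rpow_nonneg (hφ s h0 hs1).le _
    have k4 : N ≤ Q * ((1+C*h)*F) := k2.trans (by gcongr)
    have k5 : N * (1 - C*h) ≤ Q * F := by
      rcases le_total (1 - C*h) 0 with hneg | hpos
      · nlinarith [mul_nonneg hQ0 hF0, mul_nonneg hN0 (neg_nonneg.2 hneg)]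
      · have : N * (1-C*h) ≤ (Q * ((1+C*h)*F)) * (1-C*h) := by gcongr
        have e : (Q * ((1+C*h)*F)) * (1-C*h) = Q*F - Q*F*(C*h)^2 := by ring
        have : 0 ≤ Q*F*(C*h)^2 := by positivity
        linarith
    have k6 := hb s t h0 h1 h2
    have k7 : F ≤ φ t ^ (2/p-1) :=
      Real.rpow_le_rpow (hφ s h0 hs1).le (hφm s t h0 h1 h2) hap.le
    have k8 : F * φd t ≤ φ t ^ (2/p-1) * φd t := 
      mul_le_mul_of_nonneg_right k7 (hd' t ht0 h2)
    have k9 : F * (h * (r * Q)) ≤ F * (φd t - φd s) := by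
      apply mul_le_mul_of_nonneg_left (k1.trans k6) hF0
    have k10 : h * r * (N * (1-C*h)) ≤ h * r * (Q*F) := by gcongr
    have e : r * N * t - r * N * s = r * N * h := by rw [hh]; ring
    show φ t ^ (2/p-1) * φd t - r * N * t - (F * φd s - r * N * s) ≥ _
    nlinarith
  have := tele (fun t => φ t ^ (2/p) - r * N * t^2) (r * N) ?_ 1 zero_le_one le_rfl
  · simp at this; linarith
  intro s t h0 h1 h2
  have hs1 : s ≤ 1 := by linarith
  have g1 := hG s h0 hs1
  have g2 := ha s t h0 h1 h2
  have fs := hφ s h0 hs1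
  have ft := hφ t (by linarith) h2
  -- tangent line of x^(2/p)
  have g3 : φ s ^ (2/p) + (2/p) * φ s ^ (2/p-1) * (φ t - φ s) ≤ φ t ^ (2/p) := by
    have := one_add_mul_self_le_rpow_one_add (s := φ t/φ s - 1) (p := 2/p)
      (by have : 0 < φ t / φ s := by positivity
          linarith) (by linarith)
    rw [add_sub_cancel, Real.div_rpow ft.le fs.le, le_div_iff₀ (by positivity)] at this
    have e : φ s ^ (2/p) = φ s ^ (2/p-1) * φ s := by
      rw [← Real.rpow_add_one fs.ne']; simp
    have e2 : (1 + 2/p * (φ t/φ s - 1)) * φ s ^ (2/p) =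
      φ s ^ (2/p) + (2/p) * φ s ^ (2/p-1) * (φ t - φ s) := by
      rw [e]; field_simp
    linarith
  have hF0 : 0 ≤ φ s ^ (2/p-1) := by positivity
  have g4 : (2/p) * φ s ^ (2/p-1) * ((t-s)*(p*φd s)) ≤ (2/p) * φ s ^ (2/p-1) * (φ t - φ s) := by
    gcongr
  have e : (2/p) * φ s ^ (2/p-1) * ((t-s)*(p*φd s)) = 2*(t-s)*(φ s ^ (2/p-1) * φd s) := by
    field_simp
  have g5 : 2*(t-s)*(r*N*s) ≤ 2*(t-s)*(φ s ^ (2/p-1) * φd s) := by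
    apply mul_le_mul_of_nonneg_left g1; linarith
  show φ t ^ (2/p) - r * N * t^2 - (φ s ^ (2/p) - r * N * s^2) ≥ _
  nlinarith

section mat
variable {n : Type*} [Fintype n] [DecidableEq n]

/-- `U diag(f) Uᴴ` -/
noncomputable def spec (U : Matrix n n ℂ) (f : n → ℝ) : Matrix n n ℂ :=
  U * diagonal (fun k => (f k : ℂ)) * Uᴴ

theorem spec_one (U : Matrix n n ℂ) (hU : U * Uᴴ = 1) : spec U (fun _ => 1) = 1 := by
  simp [spec, hU]

theorem spec_mul (U : Matrix n n ℂ) (hU : U * Uᴴ = 1) (f g : n → ℝ) :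
    spec U f * spec U g = spec U (fun k => f k * g k) := by
  have hU' : Uᴴ * U = 1 := mul_eq_one_comm.1 hU
  unfold spec
  have : diagonal (fun k => ((f k * g k : ℝ) : ℂ)) =
    diagonal (fun k => (f k : ℂ)) * diagonal (fun k => (g k : ℂ)) := by
    rw [diagonal_mul_diagonal]; simp
  rw [this]
  calc _ = U * diagonal (fun k => (f k : ℂ)) * (Uᴴ * U) * diagonal (fun k => (g k : ℂ)) * Uᴴ := by
        simp only [mul_assoc]
    _ = _ := by rw [hU']; simp only [mul_assoc, one_mul]

theorem spec_add (U : Matrix n n ℂ) (f g : n → ℝ) :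
    spec U (fun k => f k + g k) = spec U f + spec U g := by
  unfold spec
  have : diagonal (fun k => ((f k + g k : ℝ) : ℂ)) =
    diagonal (fun k => (f k : ℂ)) + diagonal (fun k => (g k : ℂ)) := by
    rw [diagonal_add]; simp
  rw [this, mul_add, add_mul]

theorem spec_const (U : Matrix n n ℂ) (hU : U * Uᴴ = 1) (c : ℝ) :
    spec U (fun _ => c) = diagonal (fun _ => (c:ℂ)) := by
  unfold spec
  have : diagonal (fun _ : n => (c:ℂ)) = (c:ℂ) • (1 : Matrix n n ℂ) := by
    rw [smul_one_eq_diagonal]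
  rw [this]; simp [hU]

theorem trace_formula (Z U W : Matrix n n ℂ) (f g : n → ℝ) :
    (trace (Zᴴ * spec U f * Z * spec W g)).re =
      ∑ k, ∑ l, Complex.normSq ((Uᴴ * Z * W) k l) * f k * g l := by
  have : trace (Zᴴ * spec U f * Z * spec W g) = 
     trace ((Uᴴ * Z * W)ᴴ * diagonal (fun k => (f k : ℂ)) * (Uᴴ * Z * W) *
      diagonal (fun k => (g k : ℂ))) := by
    unfold spec
    rw [conjTranspose_mul, conjTranspose_mul, conjTranspose_conjTranspose]
    simp only [← mul_assoc]
    rw [trace_mul_comm]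
    simp only [← mul_assoc]
  rw [this]
  generalize (Uᴴ * Z * W) = M
  rw [Finset.sum_comm]
  simp only [trace, diag_apply, Complex.re_sum]
  refine Finset.sum_congr rfl fun l _ => ?_
  rw [mul_diagonal, mul_apply, Finset.sum_mul, Complex.re_sum]
  refine Finset.sum_congr rfl fun k _ => ?_
  rw [mul_diagonal, conjTranspose_apply]
  simp [Complex.normSq_apply]
  left; ring

theorem spec_diag (U : Matrix n n ℂ) (f : n → ℝ) (i : n) :
    spec U f i i = ((∑ k, Complex.normSq (U i k) * f k : ℝ) : ℂ) := by
  unfold spec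
  rw [mul_apply]
  push_cast
  refine Finset.sum_congr rfl fun k _ => ?_
  rw [mul_diagonal, conjTranspose_apply, Complex.normSq_eq_conj_mul_self]
  simp; ring

theorem row_sum (U : Matrix n n ℂ) (hU : U * Uᴴ = 1) (i : n) :
    ∑ k, Complex.normSq (U i k) = 1 := by
  have := spec_diag U (fun _ => 1) i
  rw [spec_one U hU] at this
  simp at this
  exact_mod_cast this.symm

theorem col_sum (U : Matrix n n ℂ) (hU : U * Uᴴ = 1) (k : n) :
    ∑ i, Complex.normSq (U i k) = 1 := by
  have hU' : Uᴴ * U = 1 := mul_eq_one_comm.1 hU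
  have := row_sum Uᴴ (by simpa using hU') k
  simpa [Complex.normSq_conj] using this

theorem trace_spec_diag (U : Matrix n n ℂ) (f y : n → ℝ) :
    (trace (spec U f * diagonal (fun k => (y k : ℂ)))).re =
      ∑ k, f k * ∑ i, y i * Complex.normSq (U i k) := by
  simp only [trace, diag_apply, mul_diagonal, spec_diag, Complex.re_sum]
  rw [Finset.sum_congr rfl (g := fun i => ∑ k, Complex.normSq (U i k) * f k * y i)
    (fun i _ => by rw [← Complex.ofReal_mul, Complex.ofReal_re, Finset.sum_mul])]
  rw [Finset.sum_comm]
  refine Finset.sum_congr rfl fun k _ => ?_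
  rw [Finset.mul_sum]
  refine Finset.sum_congr rfl fun i _ => ?_
  ring

theorem diag_pos (U : Matrix n n ℂ) (hU : U * Uᴴ = 1) (f : n → ℝ) (hf : ∀ k, 0 < f k) (i : n) :
    0 < ∑ k, Complex.normSq (U i k) * f k := by
  have h := row_sum U hU i
  have h0 : ∀ k, 0 ≤ Complex.normSq (U i k) * f k := fun k =>
    mul_nonneg (Complex.normSq_nonneg _) (hf k).le
  apply lt_of_le_of_ne (Finset.sum_nonneg fun k _ => h0 k)
  intro he
  have := (Finset.sum_eq_zero_iff_of_nonneg (fun k _ => h0 k)).1 he.symm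
  have z : ∑ k, Complex.normSq (U i k) = 0 := Finset.sum_eq_zero fun k hk => by
    have := this k hk
    rcases mul_eq_zero.1 this with h | h
    · exact h
    · exact absurd h (hf k).ne'
  linarith

theorem herm_spec (A : Matrix n n ℂ) (hA : A.IsHermitian) :
    ∃ U : Matrix n n ℂ, U * Uᴴ = 1 ∧ A = spec U hA.eigenvalues := by
  refine ⟨hA.eigenvectorUnitary, ?_, ?_⟩
  · exact Unitary.mul_star_self_of_mem (hA.eigenvectorUnitary).2
  · conv_lhs => rw [hA.spectral_theorem, Unitary.conjStarAlgAut_apply]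
    rfl

theorem spec_inv (U : Matrix n n ℂ) (hU : U * Uᴴ = 1) (α : n → ℝ) (hα : ∀ k, 0 < α k) :
    spec U α * spec U (fun k => (α k)⁻¹) = 1 := by
  rw [spec_mul U hU]
  have : (fun k => α k * (α k)⁻¹) = fun _ => (1:ℝ) := by
    ext k; exact mul_inv_cancel₀ (hα k).ne'
  rw [this, spec_one U hU]

/-- normalising: a decomposition of `D A D` and the relation between inverses -/
theorem normalise (U : Matrix n n ℂ) (hU : U * Uᴴ = 1) (α d : n → ℝ) (hα : ∀ k, 0 < α k)
    (hd : ∀ k, 0 < d k) :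
    ∃ (V : Matrix n n ℂ) (γ : n → ℝ), V * Vᴴ = 1 ∧ (∀ k, 0 < γ k) ∧
      spec V γ = diagonal (fun k => (d k : ℂ)) * spec U α * diagonal (fun k => (d k : ℂ)) ∧
      spec U (fun k => (α k)⁻¹) =
        diagonal (fun k => (d k : ℂ)) * spec V (fun k => (γ k)⁻¹) * diagonal (fun k => (d k : ℂ)) := by
  set D := diagonal (fun k => (d k : ℂ)) with hD
  set D' := diagonal (fun k => ((d k)⁻¹ : ℂ)) with hD'
  have hDD : D' * D = 1 := by
    rw [hD, hD', diagonal_mul_diagonal, ← diagonal_one]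
    congr 1; ext k
    have : (d k : ℂ) ≠ 0 := by exact_mod_cast (hd k).ne'
    field_simp
  have hDH : Dᴴ = D := by
    rw [hD, diagonal_conjTranspose]; congr 1; ext k; simp
  have hpd : (D * spec U α * D).PosDef := by
    have h1 : (diagonal (fun k => (α k : ℂ))).PosDef :=
      PosDef.diagonal (fun k => by exact_mod_cast hα k)
    have hu : IsUnit (D * U) := by
      have : (Uᴴ * D') * (D * U) = 1 := by
        calc _ = Uᴴ * (D' * D) * U := by simp only [mul_assoc]
          _ = 1 := by rw [hDD, mul_one]; exact mul_eq_one_comm.1 hU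
      exact IsUnit.of_mul_eq_one_right _ this
    have := (hu.posDef_star_right_conjugate_iff (x := diagonal (fun k => (α k : ℂ)))).2 h1
    convert this using 1
    rw [star_eq_conjTranspose, conjTranspose_mul, hDH, spec]
    simp only [mul_assoc]
  obtain ⟨V, hV, hVe⟩ := herm_spec _ hpd.1
  refine ⟨V, hpd.1.eigenvalues, hV, fun k => hpd.eigenvalues_pos k, hVe.symm, ?_⟩
  have h1 := spec_inv V hV _ (fun k => hpd.eigenvalues_pos k)
  rw [← hVe] at h1
  have h2 : spec U α * (D * spec V (fun k => (hpd.1.eigenvalues k)⁻¹) * D) = 1 := by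
    calc _ = (D' * D) * (spec U α * (D * spec V (fun k => (hpd.1.eigenvalues k)⁻¹) * D)) := by
          rw [hDD, one_mul]
      _ = D' * (D * spec U α * D * spec V (fun k => (hpd.1.eigenvalues k)⁻¹)) * D := by
          simp only [mul_assoc]
      _ = 1 := by rw [h1, mul_one, hDD]
  have h3 := mul_eq_one_comm.1 (spec_inv U hU α hα)
  calc _ = spec U (fun k => (α k)⁻¹) * (spec U α * (D * spec V (fun k => (hpd.1.eigenvalues k)⁻¹) * D)) := by rw [h2, mul_one]
    _ = _ := by rw [← mul_assoc, h3, one_mul]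

theorem amgm3 (x y : ℝ) (hx : 0 < x) (hy : 0 < y) : 3 - x - y ≤ x⁻¹ * y⁻¹ := by
  rw [← mul_inv, ← one_div, le_div_iff₀ (by positivity)]
  nlinarith [sq_nonneg (x-y), mul_pos hx hy, sq_nonneg (x+y-2), sq_nonneg (x*y-1),
    mul_nonneg hx.le (sq_nonneg (y-1)), mul_nonneg hy.le (sq_nonneg (x-1)), 
    mul_nonneg (add_pos hx hy).le (sq_nonneg (x-y)), mul_nonneg (add_pos hx hy).le (sq_nonneg (x+y-2))]

theorem res_ineq (U W : Matrix n n ℂ) (hU : U * Uᴴ = 1) (hW : W * Wᴴ = 1) (α β y a b : n → ℝ)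
    (hα : ∀ k, 0 < α k) (hβ : ∀ k, 0 < β k)
    (hY : spec U α - spec W β = diagonal (fun k => (y k : ℂ)))
    (ha : ∀ i, a i = ∑ k, Complex.normSq (U i k) * α k)
    (hb : ∀ i, b i = ∑ k, Complex.normSq (W i k) * β k) :
    ∑ i, y i * ((b i)⁻¹ - (a i)⁻¹) ≤
      ∑ k, (β k)⁻¹ * (∑ i, y i * Complex.normSq (W i k)) -
      ∑ k, (α k)⁻¹ * (∑ i, y i * Complex.normSq (U i k)) := by
  have ha0 : ∀ i, 0 < a i := fun i => by rw [ha]; exact diag_pos U hU α hα i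
  have hb0 : ∀ i, 0 < b i := fun i => by rw [hb]; exact diag_pos W hW β hβ i
  have hyab : ∀ i, y i = a i - b i := fun i => by
    have := congrFun (congrFun hY i) i
    rw [Matrix.sub_apply, spec_diag, spec_diag, diagonal_apply_eq, ← ha, ← hb] at this
    exact_mod_cast this.symm
  rw [← trace_spec_diag, ← trace_spec_diag, ← Complex.sub_re, ← trace_sub, ← sub_mul]
  set d : n → ℝ := fun i => (√(a i))⁻¹ with hd
  set e : n → ℝ := fun i => (√(b i))⁻¹ with he
  have hd0 : ∀ i, 0 < d i := fun i => by have := ha0 i; simp only [hd]; positivity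
  have he0 : ∀ i, 0 < e i := fun i => by have := hb0 i; simp only [he]; positivity
  have hd2 : ∀ i, d i ^ 2 = (a i)⁻¹ := fun i => by
    simp only [hd]; rw [inv_pow, Real.sq_sqrt (ha0 i).le]
  have he2 : ∀ i, e i ^ 2 = (b i)⁻¹ := fun i => by
    simp only [he]; rw [inv_pow, Real.sq_sqrt (hb0 i).le]
  obtain ⟨V, γ, hV, hγ, hV1, hV2⟩ := normalise U hU α d hα hd0
  obtain ⟨X, η, hX, hη, hX1, hX2⟩ := normalise W hW β e hβ he0
  set Y := diagonal (fun k => (y k : ℂ)) with hYd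
  set D := diagonal (fun k => (d k : ℂ)) with hD
  set E := diagonal (fun k => (e k : ℂ)) with hE
  set Ai := spec U (fun k => (α k)⁻¹) with hAi
  set Bi := spec W (fun k => (β k)⁻¹) with hBi
  have r1 : Bi - Ai = Ai * Y * Bi := by
    rw [← hY, mul_sub, sub_mul, mul_assoc Ai (spec W β) Bi, spec_inv W hW β hβ,
      mul_eq_one_comm.1 (spec_inv U hU α hα)]
    simp
  set z : n → ℝ := fun i => d i * y i * e i with hz
  set Z := diagonal (fun k => (z k : ℂ)) with hZ
  have hZ1 : Z = D * Y * E := by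
    rw [hZ, hD, hYd, hE, diagonal_mul_diagonal, diagonal_mul_diagonal]
    congr 1; ext k; simp [hz]
  have hZ2 : Zᴴ = E * Y * D := by
    rw [hZ, hD, hYd, hE, diagonal_mul_diagonal, diagonal_mul_diagonal, diagonal_conjTranspose]
    congr 1; ext k; simp [hz]; ring
  have hZH : Zᴴ = Z := by
    rw [hZ, diagonal_conjTranspose]; congr 1; ext k; simp
  have r2 : trace ((Bi - Ai) * Y) =
      trace (Zᴴ * spec V (fun k => (γ k)⁻¹) * Z * spec X (fun k => (η k)⁻¹)) := by
    rw [r1, hV2, hX2, hZ2, hZ1]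
    calc _ = trace ((D * spec V (fun k => (γ k)⁻¹) * D * Y * E * spec X (fun k => (η k)⁻¹)) * (E * Y)) := by
          simp only [mul_assoc]
      _ = trace ((E * Y) * (D * spec V (fun k => (γ k)⁻¹) * D * Y * E * spec X (fun k => (η k)⁻¹))) := trace_mul_comm _ _
      _ = _ := by simp only [mul_assoc]
  rw [r2, trace_formula]
  have f1 := trace_formula Z V X (fun _ => 1) (fun _ => 1)
  have f2 := trace_formula Z V X γ (fun _ => 1)
  have f3 := trace_formula Z V X (fun _ => 1) η
  rw [spec_one X hX] at f1 f2
  rw [spec_one V hV] at f1 f3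
  have zz : ∀ i, z i ^ 2 = y i * ((b i)⁻¹ - (a i)⁻¹) := fun i => by
    have : z i ^ 2 = d i ^2 * e i ^2 * (y i)^2 := by simp only [hz]; ring
    rw [this, hd2, he2, hyab]
    have := (ha0 i).ne'
    have := (hb0 i).ne'
    field_simp
  have g1 : (trace (Zᴴ * 1 * Z * 1)).re = ∑ i, z i ^ 2 := by
    rw [hZH, mul_one, mul_one, hZ, diagonal_mul_diagonal, trace_diagonal, Complex.re_sum]
    refine Finset.sum_congr rfl fun i _ => ?_
    rw [← Complex.ofReal_mul, Complex.ofReal_re]; ring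
  have g2 : (trace (Zᴴ * spec V γ * Z * 1)).re = ∑ i, z i ^ 2 := by
    rw [hZH, mul_one, hV1, hZ, hD, trace, Complex.re_sum]
    refine Finset.sum_congr rfl fun i _ => ?_
    rw [diag_apply, mul_diagonal, diagonal_mul, mul_diagonal, diagonal_mul, spec_diag, ← ha]
    simp only [← Complex.ofReal_mul, Complex.ofReal_re]
    have : z i * (d i * a i * d i) * z i = z i ^2 * (d i^2 * a i) := by ring
    rw [this, hd2, inv_mul_cancel₀ (ha0 i).ne', mul_one]
  have g3 : (trace (Zᴴ * 1 * Z * spec X η)).re = ∑ i, z i ^ 2 := by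
    rw [hZH, mul_one, hX1, hZ, hE, diagonal_mul_diagonal, trace, Complex.re_sum]
    refine Finset.sum_congr rfl fun i _ => ?_
    rw [diag_apply, diagonal_mul, mul_diagonal, diagonal_mul, spec_diag, ← hb]
    simp only [← Complex.ofReal_mul, Complex.ofReal_re]
    have : z i * z i * (e i * b i * e i) = z i ^2 * (e i^2 * b i) := by ring
    rw [this, he2, inv_mul_cancel₀ (hb0 i).ne', mul_one]
  rw [g1] at f1
  rw [g2] at f2
  rw [g3] at f3
  have : ∑ k, ∑ l, Complex.normSq ((Vᴴ * Z * X) k l) * (3 - γ k - η l) ≤ 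
    ∑ k, ∑ l, Complex.normSq ((Vᴴ * Z * X) k l) * (γ k)⁻¹ * (η l)⁻¹ := by
    refine Finset.sum_le_sum fun k _ => Finset.sum_le_sum fun l _ => ?_
    have := mul_le_mul_of_nonneg_left (amgm3 _ _ (hγ k) (hη l))
      (Complex.normSq_nonneg ((Vᴴ * Z * X) k l))
    linarith
  have e1 : ∑ k, ∑ l, Complex.normSq ((Vᴴ * Z * X) k l) * (3 - γ k - η l) = 
      3 * (∑ k, ∑ l, Complex.normSq ((Vᴴ * Z * X) k l) * 1 * 1) - 
      (∑ k, ∑ l, Complex.normSq ((Vᴴ * Z * X) k l) * γ k * 1) -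
      (∑ k, ∑ l, Complex.normSq ((Vᴴ * Z * X) k l) * 1 * η l) := by
    simp only [Finset.mul_sum, ← Finset.sum_sub_distrib]
    refine Finset.sum_congr rfl fun k _ => Finset.sum_congr rfl fun l _ => ?_
    ring
  rw [e1, ← f1, ← f2, ← f3] at this
  simp only [← zz]
  linarith

open MeasureTheory in
theorem gap (r : ℝ) (hr0 : 0 < r) (hr1 : r < 1)
    (U W : Matrix n n ℂ) (hU : U * Uᴴ = 1) (hW : W * Wᴴ = 1) (α β y a b : n → ℝ)
    (hα : ∀ k, 0 < α k) (hβ : ∀ k, 0 < β k)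
    (hY : spec U α - spec W β = diagonal (fun k => (y k : ℂ)))
    (ha : ∀ i, a i = ∑ k, Complex.normSq (U i k) * α k)
    (hb : ∀ i, b i = ∑ k, Complex.normSq (W i k) * β k) :
    ∑ i, y i * ((a i)^r - (b i)^r) ≤
      ∑ k, (α k)^r * (∑ i, y i * Complex.normSq (U i k)) -
      ∑ k, (β k)^r * (∑ i, y i * Complex.normSq (W i k)) := by
  obtain ⟨μ, hμ⟩ := Real.exists_measure_rpow_eq_integral_rpowIntegrand₀₁ (p := r) ⟨hr0, hr1⟩
  have ha0 : ∀ i, 0 < a i := fun i => by rw [ha]; exact diag_pos U hU α hα i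
  have hb0 : ∀ i, 0 < b i := fun i => by rw [hb]; exact diag_pos W hW β hβ i
  set R := Real.rpowIntegrand₀₁ r with hR
  set q := fun k => ∑ i, y i * Complex.normSq (U i k) with hq
  set q' := fun k => ∑ i, y i * Complex.normSq (W i k) with hq'
  have iα := fun k => (hμ (α k) (hα k).le).1
  have iβ := fun k => (hμ (β k) (hβ k).le).1
  have ia := fun k => (hμ (a k) (ha0 k).le).1
  have ib := fun k => (hμ (b k) (hb0 k).le).1
  have I1 : IntegrableOn (fun t => ∑ i, y i * (R t (a i) - R t (b i))) (Set.Ioi 0) μ := 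
    integrable_finsetSum _ fun i _ => ((ia i).sub (ib i)).const_mul _
  have I2 : IntegrableOn (fun t => ∑ k, R t (α k) * q k) (Set.Ioi 0) μ := 
    integrable_finsetSum _ fun i _ => (iα i).mul_const _
  have I3 : IntegrableOn (fun t => ∑ k, R t (β k) * q' k) (Set.Ioi 0) μ := 
    integrable_finsetSum _ fun i _ => (iβ i).mul_const _
  have E1 : ∑ i, y i * ((a i)^r - (b i)^r) =
      ∫ t in Set.Ioi 0, ∑ i, y i * (R t (a i) - R t (b i)) ∂μ := by
    rw [integral_finsetSum (f := fun i t => y i * (R t (a i) - R t (b i))) _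
      fun i _ => ((ia i).sub (ib i)).const_mul _]
    refine Finset.sum_congr rfl fun i _ => ?_
    rw [integral_const_mul]
    rw [(hμ (a i) (ha0 i).le).2, (hμ (b i) (hb0 i).le).2]
    rw [integral_sub (ia i) (ib i)]
  have E2 : ∑ k, (α k)^r * q k = ∫ t in Set.Ioi 0, ∑ k, R t (α k) * q k ∂μ := by
    rw [integral_finsetSum _ fun i _ => (iα i).mul_const _]
    refine Finset.sum_congr rfl fun i _ => ?_
    rw [integral_mul_const, (hμ (α i) (hα i).le).2]
  have E3 : ∑ k, (β k)^r * q' k = ∫ t in Set.Ioi 0, ∑ k, R t (β k) * q' k ∂μ := by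
    rw [integral_finsetSum _ fun i _ => (iβ i).mul_const _]
    refine Finset.sum_congr rfl fun i _ => ?_
    rw [integral_mul_const, (hμ (β i) (hβ i).le).2]
  rw [E1, E2, E3, ← integral_sub I2 I3]
  refine setIntegral_mono_on I1 (I2.sub I3) measurableSet_Ioi fun t ht => ?_
  have ht : 0 < t := ht
  have key := res_ineq U W hU hW (fun k => t + α k) (fun k => t + β k) y
    (fun i => t + a i) (fun i => t + b i) (fun k => add_pos ht (hα k)) (fun k => add_pos ht (hβ k))
    (by rw [spec_add U (fun _ => t) α, spec_add W (fun _ => t) β, spec_const U hU, spec_const W hW, ← hY]; abel)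
    (fun i => by simp only [mul_add, Finset.sum_add_distrib, ← Finset.sum_mul, row_sum U hU, ha]; ring)
    (fun i => by simp only [mul_add, Finset.sum_add_distrib, ← Finset.sum_mul, row_sum W hW, hb]; ring)
  have sq : ∑ k, q k = ∑ i, y i := by
    simp only [hq]; rw [Finset.sum_comm]
    refine Finset.sum_congr rfl fun i _ => ?_
    rw [← Finset.mul_sum, row_sum U hU, mul_one]
  have sq' : ∑ k, q' k = ∑ i, y i := by
    simp only [hq']; rw [Finset.sum_comm]
    refine Finset.sum_congr rfl fun i _ => ?_
    rw [← Finset.mul_sum, row_sum W hW, mul_one]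
  have key2 := mul_le_mul_of_nonneg_left key (Real.rpow_nonneg ht.le r)
  have l1 : ∑ i, y i * (R t (a i) - R t (b i)) = t^r * ∑ i, y i * ((t + b i)⁻¹ - (t + a i)⁻¹) := by
    rw [Finset.mul_sum]
    refine Finset.sum_congr rfl fun i _ => ?_
    simp only [hR, Real.rpowIntegrand₀₁]; ring
  have l2 : ∀ (c s : n → ℝ), ∑ k, R t (c k) * s k = t^r * t⁻¹ * ∑ k, s k - t^r * ∑ k, (t + c k)⁻¹ * s k := by
    intro c s
    rw [Finset.mul_sum, Finset.mul_sum, ← Finset.sum_sub_distrib]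
    refine Finset.sum_congr rfl fun i _ => ?_
    simp only [hR, Real.rpowIntegrand₀₁]; ring
  show ∑ i, y i * (R t (a i) - R t (b i)) ≤ ∑ k, R t (α k) * q k - ∑ k, R t (β k) * q' k
  rw [l1, l2, l2, sq, sq']
  simp only [hq, hq']
  linarith

/-- Klein inequality -/
theorem klein (p : ℝ) (hp : 1 < p) (U W : Matrix n n ℂ) (hU : U * Uᴴ = 1) (hW : W * Wᴴ = 1)
    (α β : n → ℝ) (hα : ∀ k, 0 < α k) (hβ : ∀ k, 0 < β k) :
    p * (trace (spec W (fun k => β k ^ (p-1)) * (spec U α - spec W β))).re ≤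
      ∑ k, α k ^ p - ∑ k, β k ^ p := by
  have tf : ∀ f g : n → ℝ, (trace (spec W g * spec U f)).re =
      ∑ k, ∑ l, Complex.normSq ((Uᴴ * W) k l) * f k * g l := by
    intro f g
    have := trace_formula 1 U W f g
    rw [trace_mul_comm]
    simpa using this
  have hUW : (Uᴴ * W) * (Uᴴ * W)ᴴ = 1 := by
    rw [conjTranspose_mul, conjTranspose_conjTranspose]
    calc _ = Uᴴ * (W * Wᴴ) * U := by simp only [mul_assoc]
      _ = 1 := by rw [hW, mul_one]; exact mul_eq_one_comm.1 hU
  have h1 : (trace (spec W (fun k => β k ^ (p-1)) * spec W β)).re = ∑ k, β k ^ p := by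
    rw [spec_mul W hW]
    have : (fun k => β k ^ (p-1) * β k) = fun k => β k ^ p := by
      ext k; rw [← Real.rpow_add_one (hβ k).ne']; simp
    rw [this]
    simp only [trace, diag_apply, spec_diag, Complex.re_sum, Complex.ofReal_re]
    rw [Finset.sum_comm]
    refine Finset.sum_congr rfl fun k _ => ?_
    rw [← Finset.sum_mul, col_sum W hW, one_mul]
  rw [mul_sub, trace_sub, Complex.sub_re, h1, tf]
  set c := fun k l => Complex.normSq ((Uᴴ * W) k l) with hc
  have ea : ∑ k, α k ^ p = ∑ k, ∑ l, c k l * α k ^ p := by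
    refine Finset.sum_congr rfl fun k _ => ?_
    rw [← Finset.sum_mul, row_sum _ hUW, one_mul]
  have eb : ∑ l, β l ^ p = ∑ k, ∑ l, c k l * β l ^ p := by
    rw [Finset.sum_comm]
    refine Finset.sum_congr rfl fun k _ => ?_
    rw [← Finset.sum_mul, col_sum _ hUW, one_mul]
  rw [ea, eb, mul_sub, Finset.mul_sum, Finset.mul_sum]
  rw [← Finset.sum_sub_distrib, ← Finset.sum_sub_distrib]
  refine Finset.sum_le_sum fun k _ => ?_
  rw [Finset.mul_sum, Finset.mul_sum, ← Finset.sum_sub_distrib, ← Finset.sum_sub_distrib]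
  refine Finset.sum_le_sum fun l _ => ?_
  have hc0 : 0 ≤ c k l := Complex.normSq_nonneg _
  have tan : p * (α k * β l ^ (p-1)) - p * β l ^ p ≤ α k ^ p - β l ^ p := by
    have b0 := hβ l
    have a0 := hα k
    have := one_add_mul_self_le_rpow_one_add (s := α k/β l - 1) (p := p)
      (by have : 0 < α k / β l := by positivity
          linarith) hp.le
    rw [add_sub_cancel, Real.div_rpow a0.le b0.le, le_div_iff₀ (by positivity)] at this
    have e : β l ^ p = β l ^ (p-1) * β l := by
      rw [← Real.rpow_add_one b0.ne']; simp
    have e2 : (1 + p * (α k/β l - 1)) * β l ^ p =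
      β l ^ p + (p * (α k * β l ^ (p-1)) - p * β l ^ p) := by
      rw [e]; field_simp
    linarith
  have := mul_le_mul_of_nonneg_left tan hc0
  show p * (c k l * α k * β l ^ (p-1)) - p * (c k l * β l ^ p) ≤ _
  linarith

theorem peierls (p : ℝ) (hp : 1 < p) (U : Matrix n n ℂ) (hU : U * Uᴴ = 1)
    (α : n → ℝ) (hα : ∀ k, 0 < α k) :
    ∑ i, (∑ k, Complex.normSq (U i k) * α k)^p ≤ ∑ k, α k ^ p := by
  calc _ ≤ ∑ i, ∑ k, Complex.normSq (U i k) * α k ^ p := by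
        refine Finset.sum_le_sum fun i _ => ?_
        exact Real.rpow_arith_mean_le_arith_mean_rpow _ _ _ (fun k _ => Complex.normSq_nonneg _)
          (row_sum U hU i) (fun k _ => (hα k).le) hp.le
    _ = _ := by
      rw [Finset.sum_comm]
      refine Finset.sum_congr rfl fun k _ => ?_
      rw [← Finset.sum_mul, col_sum _ hU, one_mul]

end mat

section final
variable {n : Type*} [Fintype n] [DecidableEq n]

theorem spec_conj (V U : Matrix n n ℂ) (f : n → ℝ) :
    Vᴴ * spec U f * V = spec (Vᴴ * U) f := by
  unfold spec
  rw [conjTranspose_mul, conjTranspose_conjTranspose]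
  simp only [mul_assoc]

theorem spec_commute (U P : Matrix n n ℂ) (hU : U * Uᴴ = 1) (α : n → ℝ) (g : ℝ → ℝ)
    (h : P * spec U α = spec U α * P) :
    P * spec U (fun k => g (α k)) = spec U (fun k => g (α k)) * P := by
  have hU' : Uᴴ * U = 1 := mul_eq_one_comm.1 hU
  set N := Uᴴ * P * U with hN
  have key : ∀ f : n → ℝ, (P * spec U f = spec U f * P) ↔
      N * diagonal (fun k => (f k : ℂ)) = diagonal (fun k => (f k : ℂ)) * N := by
    intro f
    have e1 : Uᴴ * (P * spec U f) * U = N * diagonal (fun k => (f k : ℂ)) := by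
      unfold spec
      calc _ = Uᴴ * P * U * diagonal (fun k => (f k : ℂ)) * (Uᴴ * U) := by simp only [mul_assoc]
        _ = _ := by rw [hU', mul_one]
    have e2 : Uᴴ * (spec U f * P) * U = diagonal (fun k => (f k : ℂ)) * N := by
      unfold spec
      calc _ = (Uᴴ * U) * diagonal (fun k => (f k : ℂ)) * (Uᴴ * P * U) := by simp only [mul_assoc]
        _ = _ := by rw [hU', one_mul]
    constructor
    · intro h; rw [← e1, ← e2, h]
    · intro h
      rw [← e1, ← e2] at h
      have : ∀ X : Matrix n n ℂ, U * (Uᴴ * X * U) * Uᴴ = X := by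
        intro X
        calc _ = (U * Uᴴ) * X * (U * Uᴴ) := by simp only [mul_assoc]
          _ = X := by rw [hU]; simp
      rw [← this (P * spec U f), h, this]
  rw [key] at h ⊢
  ext i j
  have := congrFun (congrFun h i) j
  rw [mul_diagonal, diagonal_mul] at this ⊢
  have h2 : N i j * ((α j : ℂ) - α i) = 0 := by linear_combination this
  rcases mul_eq_zero.1 h2 with h3 | h3
  · simp [h3]
  · have : α j = α i := by exact_mod_cast sub_eq_zero.1 h3
    rw [this]; ring

theorem core_mat (r : ℝ) (hr0 : 0 < r) (hr1 : r < 1) (δ : ℝ) (hδ : 0 < δ)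
    (H0 H1 U0 U1 : Matrix n n ℂ) (h0 : H0.PosSemidef) (h1 : H1.PosSemidef) (y α0 α1 : n → ℝ)
    (hY : H1 - H0 = diagonal (fun k => (y k : ℂ)))
    (hU0 : U0 * U0ᴴ = 1) (hU1 : U1 * U1ᴴ = 1) (hα0 : ∀ k, 0 ≤ α0 k) (hα1 : ∀ k, 0 ≤ α1 k)
    (hs0 : spec U0 α0 = H0) (hs1 : spec U1 α1 = H1)
    (hort : ∀ (U : Matrix n n ℂ) (α : n → ℝ), U * Uᴴ = 1 → spec U α = H0 →
      0 ≤ (trace (spec U (fun k => (α k + δ)^r) * diagonal (fun k => (y k : ℂ)))).re) :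
    (∑ k, (α0 k + δ)^(1+r))^(2/(1+r)) + r * (∑ i, |y i|^(1+r))^(2/(1+r)) ≤
      (∑ k, (α1 k + δ)^(1+r))^(2/(1+r)) := by
  have hp : 1 < 1 + r := by linarith
  have hdec : ∀ t : ℝ, ∃ (U : Matrix n n ℂ) (l : n → ℝ), U * Uᴴ = 1 ∧ (0 ≤ t → t ≤ 1 →
      (∀ k, 0 ≤ l k) ∧ spec U l = H0 + (t:ℂ) • diagonal (fun k => (y k : ℂ))) := by
    intro t
    by_cases ht : 0 ≤ t ∧ t ≤ 1
    · have hps : (H0 + (t:ℂ) • diagonal (fun k => (y k : ℂ))).PosSemidef := by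
        have : H0 + (t:ℂ) • diagonal (fun k => (y k : ℂ)) =
            ((1 - t : ℝ) : ℂ) • H0 + (t:ℂ) • H1 := by
          rw [← hY]; push_cast; module
        rw [this]
        have q1 : (0:ℂ) ≤ ((1-t:ℝ):ℂ) := by exact_mod_cast sub_nonneg.2 ht.2
        have q2 : (0:ℂ) ≤ (t:ℂ) := by exact_mod_cast ht.1
        exact (h0.smul q1).add (h1.smul q2)
      obtain ⟨U, hU, he⟩ := herm_spec _ hps.1
      exact ⟨U, hps.1.eigenvalues, hU, fun _ _ => ⟨hps.eigenvalues_nonneg, he.symm⟩⟩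
    · exact ⟨1, fun _ => 0, by simp, fun a b => absurd ⟨a, b⟩ ht⟩
  choose U l hU hl using hdec
  set lam : ℝ → n → ℝ := fun t k => l t k + δ with hlam
  have lpos : ∀ t, 0 ≤ t → t ≤ 1 → ∀ k, 0 < lam t k := fun t a b k => by
    have := (hl t a b).1 k
    simp only [hlam]; linarith
  have hsp : ∀ t, 0 ≤ t → t ≤ 1 → spec (U t) (lam t) =
      H0 + (t:ℂ) • diagonal (fun k => (y k : ℂ)) + diagonal (fun _ => (δ:ℂ)) := fun t a b => by
    rw [hlam, spec_add (U t) (l t) (fun _ => δ), (hl t a b).2, spec_const _ (hU t)]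
  have hdiff : ∀ s t, 0 ≤ s → s ≤ t → t ≤ 1 → spec (U t) (lam t) - spec (U s) (lam s) =
      diagonal (fun k => (((t-s) * y k : ℝ) : ℂ)) := by
    intro s t a b c
    rw [hsp t (by linarith) c, hsp s a (by linarith)]
    have : diagonal (fun k => (((t-s) * y k : ℝ) : ℂ)) =
      ((t:ℂ) - s) • diagonal (fun k => (y k : ℂ)) := by
      rw [← diagonal_smul]; congr 1; ext k; simp
    rw [this]; module
  set x : n → ℝ := fun i => (H0 i i).re + δ with hx
  have hxt : ∀ t, 0 ≤ t → t ≤ 1 → ∀ i,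
      x i + t * y i = ∑ k, Complex.normSq (U t i k) * lam t k := by
    intro t a b i
    have := congrArg Complex.re (congrFun (congrFun (hsp t a b) i) i)
    rw [spec_diag, Complex.ofReal_re] at this
    rw [this]
    simp [hx]; ring
  have uniq : ∀ (t : ℝ) (W : Matrix n n ℂ) (β : n → ℝ), 0 ≤ t → t ≤ 1 → W * Wᴴ = 1 →
      (∀ k, 0 ≤ β k) → spec W β = H0 + (t:ℂ) • diagonal (fun k => (y k : ℂ)) →
      ∑ k, lam t k ^ (1+r) = ∑ k, (β k + δ)^(1+r) := by
    intro t W β a b hW hβ hWs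
    have hpos : ∀ k, 0 < β k + δ := fun k => by linarith [hβ k]
    have e : spec W (fun k => β k + δ) = spec (U t) (lam t) := by
      rw [hsp t a b, spec_add W β (fun _ => δ), hWs, spec_const _ hW]
    have k1 := klein (1+r) hp (U t) W (hU t) hW (lam t) (fun k => β k + δ) (lpos t a b) hpos
    have k2 := klein (1+r) hp W (U t) hW (hU t) (fun k => β k + δ) (lam t) hpos (lpos t a b)
    rw [e] at k1 k2
    simp only [sub_self, mul_zero, trace_zero, Complex.zero_re] at k1 k2
    linarith
  have u0 := uniq 0 U0 α0 le_rfl zero_le_one hU0 hα0 (by simp [hs0])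
  have u1 := uniq 1 U1 α1 zero_le_one le_rfl hU1 hα1 (by rw [hs1, ← hY]; simp)
  rw [← u0, ← u1]
  refine core_real r hr0 hr1 (fun t => ∑ k, lam t k ^ (1+r))
    (fun t => ∑ k, lam t k ^ r * ∑ i, y i * Complex.normSq (U t i k)) x y δ hδ ?_ ?_ ?_ ?_ ?_
  · intro t a b i
    rw [hxt t a b]
    have : ∑ k, Complex.normSq (U t i k) * δ = δ := by
      rw [← Finset.sum_mul, row_sum _ (hU t), one_mul]
    calc δ = ∑ k, Complex.normSq (U t i k) * δ := this.symm
      _ ≤ _ := Finset.sum_le_sum fun k _ => by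
        apply mul_le_mul_of_nonneg_left _ (Complex.normSq_nonneg _)
        have := (hl t a b).1 k
        simp only [hlam]; linarith
  · intro s t a b c
    have := klein (1+r) hp (U t) (U s) (hU t) (hU s) (lam t) (lam s)
      (lpos t (by linarith) c) (lpos s a (by linarith))
    rw [hdiff s t a b c, trace_spec_diag] at this
    refine le_trans (le_of_eq ?_) this
    simp only [add_sub_cancel_left, mul_assoc, ← Finset.mul_sum]
    rw [mul_left_comm]
    congr 1
    rw [Finset.mul_sum]
    refine Finset.sum_congr rfl fun k _ => ?_
    ring
  · intro s t a b c
    rcases b.eq_or_lt with he | hlt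
    · subst he; simp
    have := gap r hr0 hr1 (U t) (U s) (hU t) (hU s) (lam t) (lam s) (fun k => (t-s) * y k)
      (fun i => x i + t * y i) (fun i => x i + s * y i)
      (lpos t (by linarith) c) (lpos s a (by linarith)) (hdiff s t a b c)
      (hxt t (by linarith) c) (hxt s a (by linarith))
    have hts : 0 < t - s := by linarith
    refine le_of_mul_le_mul_left ?_ hts
    refine (le_of_eq ?_).trans (this.trans (le_of_eq ?_))
    · rw [Finset.mul_sum]
      refine Finset.sum_congr rfl fun k _ => ?_
      ring
    · simp only [mul_assoc, ← Finset.mul_sum]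
      rw [mul_sub, Finset.mul_sum, Finset.mul_sum]
      congr 1 <;>
      · refine Finset.sum_congr rfl fun k _ => ?_
        ring
  · intro t a b
    refine le_trans (le_of_eq ?_) (peierls (1+r) hp (U t) (hU t) (lam t) (lpos t a b))
    exact Finset.sum_congr rfl fun i _ => by rw [hxt t a b]
  · have := hort (U 0) (l 0) (hU 0) (by
      rw [(hl 0 le_rfl zero_le_one).2]; simp)
    rw [trace_spec_diag] at this
    exact this

end final

theorem schatten_sq {n : Type*} [Fintype n] [DecidableEq n]
    (p : ℝ) (A : Matrix n n ℂ) (hA : A.IsHermitian) :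
    schattenNorm p A hA ^ 2 = (∑ i, |hA.eigenvalues i| ^ p) ^ (2 / p) := by
  unfold schattenNorm
  rw [← Real.rpow_natCast, ← Real.rpow_mul (Finset.sum_nonneg fun i _ => by positivity)]
  congr 1; push_cast; ring

end HuangShi

open HuangShi Matrix

/-- Huang–Shi uncertainty relation: for a positive semidefinite τ and a projective
measurement {P_i} (pairwise orthogonal Hermitian idempotents summing to 1), the
pinching τ' = Σ P_i τ P_i satisfies
‖τ'‖²_{1+ε} ≤ ‖τ‖²_{1+ε} - ε‖τ - τ'‖²_{1+ε} for all ε ∈ (0,1). -/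
theorem huang_shi_pinching_inequality {n ι : Type*} [Fintype n] [DecidableEq n]
    [Fintype ι]
    (τ : Matrix n n ℂ) (hτ : τ.PosSemidef)
    (P : ι → Matrix n n ℂ)
    (hPh : ∀ i, (P i).IsHermitian)
    (hPidem : ∀ i, P i * P i = P i)
    (hPorth : ∀ i j, i ≠ j → P i * P j = 0)
    (hPsum : ∑ i, P i = 1)
    (ε : ℝ) (hε0 : 0 < ε) (hε1 : ε < 1)
    (hτ' : (∑ i, P i * τ * P i).IsHermitian)
    (hdiff : (τ - ∑ i, P i * τ * P i).IsHermitian) :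
    schattenNorm (1 + ε) (∑ i, P i * τ * P i) hτ' ^ 2
      ≤ schattenNorm (1 + ε) τ hτ.1 ^ 2
        - ε * schattenNorm (1 + ε) (τ - ∑ i, P i * τ * P i) hdiff ^ 2 := by

  classical
  have hps : (∑ i, P i * τ * P i).PosSemidef := by
    apply Matrix.posSemidef_sum
    intro i _
    have := hτ.conjTranspose_mul_mul_same (P i)
    rwa [(hPh i).eq] at this
  rw [schatten_sq, schatten_sq, schatten_sq]
  obtain ⟨V, hV, hVe⟩ := herm_spec _ hdiff
  obtain ⟨U1, hU1, hU1e⟩ := herm_spec _ hτ.1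
  obtain ⟨U0, hU0, hU0e⟩ := herm_spec _ hτ'
  have hV' : Vᴴ * V = 1 := mul_eq_one_comm.1 hV
  have n0 : ∀ k, 0 ≤ hτ'.eigenvalues k := fun k => hps.eigenvalues_nonneg k
  have n1 : ∀ k, 0 ≤ hτ.1.eigenvalues k := fun k => hτ.eigenvalues_nonneg k
  simp only [abs_of_nonneg (n0 _), abs_of_nonneg (n1 _)]
  generalize hy : hdiff.eigenvalues = y at *
  generalize hτ'.eigenvalues = α0 at *
  generalize hτ.1.eigenvalues = α1 at *
  set τ' := ∑ i, P i * τ * P i with hτ'd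
  have hcomm : ∀ i, P i * τ' = τ' * P i := by
    intro i
    have e1 : P i * τ' = P i * τ * P i := by
      rw [hτ'd, Finset.mul_sum, Finset.sum_eq_single i]
      · rw [← mul_assoc, ← mul_assoc, hPidem]
      · intro j _ hj
        rw [← mul_assoc, ← mul_assoc, hPorth i j hj.symm]; simp
      · simp
    have e2 : τ' * P i = P i * τ * P i := by
      rw [hτ'd, Finset.sum_mul, Finset.sum_eq_single i]
      · rw [mul_assoc, hPidem]
      · intro j _ hj
        rw [mul_assoc, hPorth j i hj]; simp
      · simp
    rw [e1, e2]
  have huni : ∀ X Y : Matrix n n ℂ, X * Xᴴ = 1 → Y * Yᴴ = 1 → (X * Y) * (X * Y)ᴴ = 1 := by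
    intro X Y hX hY
    rw [Matrix.conjTranspose_mul]
    calc _ = X * (Y * Yᴴ) * Xᴴ := by simp only [mul_assoc]
      _ = 1 := by rw [hY, mul_one, hX]
  have hVH : Vᴴ * Vᴴᴴ = 1 := by simpa using hV'
  have main : ∀ δ : ℝ, 0 < δ →
      (∑ k, (α0 k + δ)^(1+ε))^(2/(1+ε)) + ε * (∑ i, |y i|^(1+ε))^(2/(1+ε)) ≤
      (∑ k, (α1 k + δ)^(1+ε))^(2/(1+ε)) := by
    intro δ hδ
    refine core_mat ε hε0 hε1 δ hδ (Vᴴ * τ' * V) (Vᴴ * τ * V) (Vᴴ * U0) (Vᴴ * U1)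
      (hps.conjTranspose_mul_mul_same V) (hτ.conjTranspose_mul_mul_same V) y α0 α1 ?_
      (huni _ _ hVH hU0) (huni _ _ hVH hU1) n0 n1 ?_ ?_ ?_
    · rw [← sub_mul, ← mul_sub, hVe, spec]
      calc _ = (Vᴴ * V) * Matrix.diagonal (fun k => (y k : ℂ)) * (Vᴴ * V) := by
            simp only [mul_assoc]
        _ = _ := by rw [hV']; simp
    · rw [hU0e, spec_conj]
    · rw [hU1e, spec_conj]
    · intro U α hU hs
      have hW := huni V U hV hU
      have e : spec (V * U) α = τ' := by
        have := spec_conj Vᴴ U α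
        rw [Matrix.conjTranspose_conjTranspose] at this
        rw [← this, hs]
        calc _ = (V * Vᴴ) * τ' * (V * Vᴴ) := by simp only [mul_assoc]
          _ = τ' := by rw [hV]; simp
      set C := spec (V * U) (fun k => (α k + δ)^ε) with hC
      have hCc : ∀ i, P i * C = C * P i := fun i =>
        spec_commute (V * U) (P i) hW α (fun x => (x + δ)^ε) (by rw [e]; exact hcomm i)
      have e2 : Matrix.trace (spec U (fun k => (α k + δ)^ε) *
          Matrix.diagonal (fun k => (y k : ℂ))) = Matrix.trace (C * (τ - τ')) := by
        have : C = V * spec U (fun k => (α k + δ)^ε) * Vᴴ := by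
          have := spec_conj Vᴴ U (fun k => (α k + δ)^ε)
          rw [Matrix.conjTranspose_conjTranspose] at this
          rw [this]
        rw [hVe, this]
        unfold spec
        generalize U * Matrix.diagonal (fun k => (((α k + δ)^ε : ℝ) : ℂ)) * Uᴴ = X
        calc _ = Matrix.trace (X * Matrix.diagonal (fun k => (y k : ℂ)) * (Vᴴ * V)) := by
              rw [hV', mul_one]
          _ = Matrix.trace ((X * Matrix.diagonal (fun k => (y k : ℂ)) * Vᴴ) * V) := by
              simp only [mul_assoc]
          _ = Matrix.trace (V * (X * Matrix.diagonal (fun k => (y k : ℂ)) * Vᴴ)) :=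
              Matrix.trace_mul_comm _ _
          _ = Matrix.trace (V * X * (Vᴴ * V) * Matrix.diagonal (fun k => (y k : ℂ)) * Vᴴ) := by
              rw [hV']; simp only [mul_assoc, one_mul]
          _ = _ := by simp only [mul_assoc]
      have e3 : Matrix.trace (C * τ') = Matrix.trace (C * τ) := by
        rw [hτ'd, Finset.mul_sum, Matrix.trace_sum]
        have : ∀ i, Matrix.trace (C * (P i * τ * P i)) = Matrix.trace (C * P i * τ) := by
          intro i
          calc _ = Matrix.trace ((C * P i * τ) * P i) := by simp only [mul_assoc]
            _ = Matrix.trace (P i * (C * P i * τ)) := Matrix.trace_mul_comm _ _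
            _ = Matrix.trace ((P i * C) * P i * τ) := by simp only [mul_assoc]
            _ = Matrix.trace (C * (P i * P i) * τ) := by rw [hCc]; simp only [mul_assoc]
            _ = _ := by rw [hPidem]
        simp only [this]
        rw [← Matrix.trace_sum, ← Finset.sum_mul, ← Finset.mul_sum, hPsum, mul_one]
      rw [e2, mul_sub, Matrix.trace_sub, e3, sub_self]
      simp
  have cont : ∀ a : n → ℝ, Filter.Tendsto (fun δ : ℝ => (∑ k, (a k + δ)^(1+ε))^(2/(1+ε)))
      (nhdsWithin 0 (Set.Ioi 0)) (nhds ((∑ k, (a k)^(1+ε))^(2/(1+ε)))) := by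
    intro a
    have c : Continuous (fun δ : ℝ => (∑ k, (a k + δ)^(1+ε))^(2/(1+ε))) := by
      apply Continuous.rpow_const
      · apply continuous_finsetSum
        intro k _
        apply Continuous.rpow_const (by fun_prop)
        intro _; right; linarith
      · intro _; right; positivity
    have := (c.tendsto 0).mono_left (nhdsWithin_le_nhds (s := Set.Ioi 0))
    simpa using this
  have := le_of_tendsto_of_tendsto ((cont α0).add_const (ε * (∑ i, |y i|^(1+ε))^(2/(1+ε))))
    (cont α1) (by
      filter_upwards [self_mem_nhdsWithin] with δ hδ
      exact main δ hδ)
  linarith
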